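/- Fix integers n ≥ 1 and 0 ≤ k ≤ (n+1)/2. Let C_{n,k} be the set of words w of length n with k letters equal to 1 and n−k letters equal to 0, such that no two 1-s are adjacent, not even cyclically (w_1 = w_n = 1 is forbidden), with ℤ/nℤ acting by cyclic rotation. Let e_{n,k}(q) be the coefficient of t^k in Tr(A(q^{n−1}, t) A(q^{n−2}, t) ⋯ A(1, t)), where A(x, t) is the 2×2 matrix with rows (1, x) and (t, 0). Then the triple (C_{n,k}, ℤ/nℤ, e_{n,k}(q)) exhibits the cyclic sieving phenomenon: for every g ∈ ℤ/nℤ and every complex root of unity ω of the same order as g, |C_{n,k}^g| = e_{n,k}(ω). -/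

import Mathlib

open Polynomial Finset

/-- The matrix `A(q^i, t) = [[1, q^i], [t, 0]]`, viewed over `(ℤ[q])[t]`
(outer variable `t`, inner variable `q`). -/
noncomputable def AmatT (i : ℕ) : Matrix (Fin 2) (Fin 2) (Polynomial (Polynomial ℤ)) :=
  !![1, Polynomial.C (Polynomial.X ^ i); Polynomial.X, 0]

/-- `e_{n,k}(q) = [t^k] Tr(A(q^{n-1}, t) A(q^{n-2}, t) ⋯ A(1, t)) ∈ ℤ[q]`. -/
noncomputable def eSeq (n k : ℕ) : Polynomial ℤ :=
  (Matrix.trace (((List.range n).map (fun i => AmatT (n - 1 - i))).prod)).coeff k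

noncomputable def Am (x : ℂ) : Matrix (Fin 2) (Fin 2) ℂ[X] := !![1, C x; X, 0]

noncomputable def Qm (ω : ℂ) (x : ℂ) : ℕ → Matrix (Fin 2) (Fin 2) ℂ[X]
  | 0 => 1
  | n + 1 => Am (x * ω ^ n) * Qm ω x n

lemma Qm_succ' (ω x : ℂ) (n : ℕ) : Qm ω x (n+1) = Qm ω (x * ω) n * Am x := by
  induction n with
  | zero => simp [Qm]
  | succ n ih =>
    rw [Qm, ih, Qm, ← mul_assoc]
    congr 3
    ring

lemma eSeq_eq (n k : ℕ) (ω : ℂ) :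
    Polynomial.aeval ω (eSeq n k) = (Matrix.trace (Qm ω 1 n)).coeff k := by
  have key : ∀ n, (((List.range n).map (fun i => AmatT (n - 1 - i))).prod).map
      (Polynomial.mapRingHom (Polynomial.aeval ω : ℤ[X] →ₐ[ℤ] ℂ).toRingHom) = Qm ω 1 n := by
    intro n
    induction n with
    | zero => simp [Qm, Matrix.map_one]
    | succ n ih =>
      rw [List.range_succ_eq_map, List.map_cons, List.prod_cons, Qm, ← ih, Matrix.map_mul]
      congr 1
      · ext i j : 2
        fin_cases i <;> fin_cases j <;> simp [AmatT, Am]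
      · rw [List.map_map]
        congr 2
        apply List.map_congr_left
        intro i hi
        simp only [Function.comp]
        congr 1
        omega
  rw [← key, eSeq, ]
  simp [Matrix.trace, Fin.sum_univ_two]

lemma Qm_add (ω : ℂ) (d : ℕ) (h : ω ^ d = 1) (j : ℕ) : Qm ω 1 (j + d) = Qm ω 1 j * Qm ω 1 d := by
  induction j with
  | zero => simp [Qm]
  | succ j ih =>
    rw [show j + 1 + d = (j + d) + 1 by ring, Qm, ih, Qm, pow_add, h, mul_one, mul_assoc]

lemma Qm_mul (ω : ℂ) (d : ℕ) (h : ω ^ d = 1) (m : ℕ) : Qm ω 1 (m * d) = Qm ω 1 d ^ m := by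
  induction m with
  | zero => simp [Qm]
  | succ m ih => rw [Nat.succ_mul, Qm_add _ _ h, ih, pow_succ]

lemma trace_shift (ω : ℂ) (d : ℕ) (h : ω ^ d = 1) :
    (Qm ω ω d).trace = (Qm ω 1 d).trace := by
  cases d with
  | zero => rfl
  | succ e => rw [Qm_succ' ω 1, Qm, ← pow_succ', h, one_mul, Matrix.trace_mul_comm]

lemma Qm_scale (ω x : ℂ) (n : ℕ) :
    !![C ω, 0; 0, 1] * (Qm ω x n).map (Polynomial.compRingHom (C ω * X))
      = Qm ω (x * ω) n * !![C ω, 0; 0, 1] := by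
  induction n with
  | zero => simp [Qm]
  | succ n ih =>
    have hA : ∀ y : ℂ, !![C ω, 0; 0, 1] * (Am y).map (Polynomial.compRingHom (C ω * X))
        = Am (y * ω) * !![C ω, 0; 0, 1] := by
      intro y
      apply Matrix.ext
      intro i j
      fin_cases i <;> fin_cases j <;>
        simp [Am, Matrix.mul_apply, Fin.sum_univ_two] <;> ring
    rw [Qm, Qm, Matrix.map_mul, ← mul_assoc, hA, mul_assoc, ih, ← mul_assoc,
      show x * ω ^ n * ω = x * ω * ω ^ n by ring]

lemma trace_scale (ω : ℂ) (h0 : ω ≠ 0) (n : ℕ) :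
    (Qm ω ω n).trace = (Qm ω 1 n).trace.comp (C ω * X) := by
  have h := Qm_scale ω 1 n
  rw [one_mul] at h
  have h00 := congrFun (congrFun h 0) 0
  have h11 := congrFun (congrFun h 1) 1
  simp [Matrix.mul_apply, Fin.sum_univ_two] at h00 h11
  rw [mul_comm] at h00
  have := mul_right_cancel₀ (by simpa using h0) h00
  simp [Matrix.trace, Fin.sum_univ_two, ← h11, ← this]

lemma Qm_deg (ω x : ℂ) (n : ℕ) :
    ((Qm ω x (n+1)) 0 0).natDegree ≤ n ∧ ((Qm ω x (n+1)) 0 1).natDegree ≤ n ∧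
    ((Qm ω x (n+1)) 1 0).natDegree ≤ n + 1 ∧ ((Qm ω x (n+1)) 1 1).natDegree ≤ n ∧
    ((Qm ω x (n+1)) 0 0).coeff 0 = 1 ∧ ((Qm ω x (n+1)) 1 0).coeff 0 = 0 ∧
    ((Qm ω x (n+1)) 1 1).coeff 0 = 0 := by
  induction n with
  | zero => simp [Qm, Am]
  | succ n ih =>
    obtain ⟨h1, h2, h3, h4, h5, h6, h7⟩ := ih
    rw [Qm]
    generalize Qm ω x (n+1) = M at *
    simp only [Am, Matrix.mul_apply, Fin.sum_univ_two, Matrix.of_apply, Matrix.cons_val_zero,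
      Matrix.cons_val_one, Matrix.cons_val', Matrix.cons_val_fin_one, zero_mul, one_mul, add_zero]
    refine ⟨?_, ?_, ?_, ?_, ?_, ?_, ?_⟩
    · compute_degree!
      omega
    · compute_degree!
      all_goals omega
    · compute_degree!
      all_goals omega
    · compute_degree!
      all_goals omega
    · simp [h5, h6]
    · simp
    · simp

lemma trace_one (ω : ℂ) (d : ℕ) (hd : 0 < d) (h : IsPrimitiveRoot ω d) :
    (Qm ω 1 d).trace = 1 := by
  have hs : (Qm ω 1 d).trace = (Qm ω 1 d).trace.comp (C ω * X) := by
    rw [← trace_scale ω (h.ne_zero hd.ne'), trace_shift _ _ h.pow_eq_one]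
  obtain ⟨e, rfl⟩ : ∃ e, d = e + 1 := ⟨d - 1, by omega⟩
  obtain ⟨h1, h2, h3, h4, h5, h6, h7⟩ := Qm_deg ω 1 e
  ext j
  rcases Nat.eq_zero_or_pos j with rfl | hj
  · simp [Matrix.trace, Fin.sum_univ_two, h5, h7]
  · rw [Polynomial.coeff_one, if_neg hj.ne']
    by_cases hje : j ≤ e
    · have := congrArg (fun p => p.coeff j) hs
      simp only [Polynomial.comp_C_mul_X_coeff] at this
      have hne := h.pow_ne_one_of_pos_of_lt hj.ne' (by omega)
      by_contra hc
      apply hne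
      apply mul_left_cancel₀ hc
      rw [mul_one, ← this]
    · apply Polynomial.coeff_eq_zero_of_natDegree_lt
      rw [Matrix.trace_fin_two]
      have := Polynomial.natDegree_add_le (Qm ω 1 (e+1) 0 0) (Qm ω 1 (e+1) 1 1)
      omega

lemma det_Qm (ω : ℂ) (n : ℕ) :
    (Qm ω 1 n).det = C (∏ i ∈ range n, (-ω ^ i)) * X ^ n := by
  induction n with
  | zero => simp [Qm]
  | succ n ih =>
    rw [Qm, Matrix.det_mul, ih, prod_range_succ, Am, Matrix.det_fin_two_of]
    simp only [one_mul, map_mul, map_neg, mul_zero]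
    ring

lemma prod_neg (ω : ℂ) (d : ℕ) (hd : 0 < d) (h : IsPrimitiveRoot ω d) :
    ∏ i ∈ range d, (-ω ^ i) = -1 := by
  have hp : ∏ i ∈ range d, (-ω ^ i) = (-1) ^ d * ω ^ (∑ i ∈ range d, i) := by
    rw [← Finset.prod_pow_eq_pow_sum, Finset.prod_neg, Finset.card_range]
  have hs := Finset.sum_range_id_mul_two d
  rw [hp]
  rcases Nat.even_or_odd' d with ⟨r, hr | hr⟩
  · have hr0 : 0 < r := by omega
    have hw : ω ^ r = -1 := by
      have h1 : (ω ^ r) ^ 2 = 1 := by rw [← pow_mul, mul_comm, ← hr]; exact h.pow_eq_one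
      have h2 : ω ^ r ≠ 1 := h.pow_ne_one_of_pos_of_lt hr0.ne' (by omega)
      rcases (by simpa using h1 : ω ^ r = 1 ∨ ω ^ r = -1) with h3 | h3
      · exact absurd h3 h2
      · exact h3
    have hsum : ∑ i ∈ range d, i = r * (d - 1) := by
      have : (∑ i ∈ range d, i) * 2 = (r * (d - 1)) * 2 := by rw [hs]; nth_rw 1 [hr]; ring
      omega
    rw [hsum, pow_mul, hw, Even.neg_one_pow ⟨r, by omega⟩, Odd.neg_one_pow ⟨r - 1, by omega⟩]
    simp
  · have hsum : ∑ i ∈ range d, i = d * r := by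
      have : (∑ i ∈ range d, i) * 2 = (d * r) * 2 := by
        rw [hs, show d - 1 = r * 2 by omega]; ring
      omega
    rw [hsum, pow_mul, h.pow_eq_one, Odd.neg_one_pow ⟨r, hr⟩]
    simp

lemma det_Qm' (ω : ℂ) (d : ℕ) (hd : 0 < d) (h : IsPrimitiveRoot ω d) :
    (Qm ω 1 d).det = - X ^ d := by
  rw [det_Qm, prod_neg ω d hd h]; simp

lemma trace_pow_eq {R : Type*} [CommRing R] (M N : Matrix (Fin 2) (Fin 2) R)
    (ht : M.trace = N.trace) (hd : M.det = N.det) (m : ℕ) : (M ^ m).trace = (N ^ m).trace := by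
  have key : ∀ (M : Matrix (Fin 2) (Fin 2) R) m, (M ^ (m+2)).trace
      = M.trace * (M ^ (m+1)).trace - M.det * (M ^ m).trace := by
    intro M m
    have : M ^ 2 = M.trace • M - M.det • 1 := by
      ext i j
      fin_cases i <;> fin_cases j <;>
        simp [pow_two, Matrix.mul_apply, Fin.sum_univ_two, Matrix.det_fin_two,
          Matrix.trace_fin_two] <;> ring
    rw [pow_add, this, mul_sub, Matrix.trace_sub, pow_succ]
    simp
  induction m using Nat.strong_induction_on with
  | _ m ih =>
    match m with
    | 0 => simp
    | 1 => simpa using ht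
    | m + 2 => rw [key, key, ih m (by omega), ih (m+1) (by omega), ht, hd]

lemma pow_path {R : Type*} [CommRing R] (B : Matrix (Fin 2) (Fin 2) R) (m : ℕ) (a b : Fin 2) :
    (B ^ (m+1)) a b = ∑ w : Fin m → Fin 2, ∏ i : Fin (m+1),
      B (Fin.cons (α := fun _ => Fin 2) a w i) (Fin.snoc (α := fun _ => Fin 2) w b i) := by
  induction m generalizing a b with
  | zero => simp [Fin.snoc]
  | succ m ih =>
    rw [pow_succ', Matrix.mul_apply, ← (Fin.consEquiv (fun _ : Fin (m+1) => Fin 2)).sum_comp,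
      Fintype.sum_prod_type]
    apply Finset.sum_congr rfl
    intro c _
    rw [ih, Finset.mul_sum]
    apply Finset.sum_congr rfl
    intro w _
    rw [Fin.prod_univ_succ (n := m+1)]
    simp only [Fin.consEquiv, Equiv.coe_fn_mk, Fin.cons_zero, Fin.cons_succ,
      ← Fin.cons_snoc_eq_snoc_cons]

lemma trace_pow_cyc {R : Type*} [CommRing R] (B : Matrix (Fin 2) (Fin 2) R) (m : ℕ) [NeZero m] :
    (B ^ m).trace = ∑ w : ZMod m → Fin 2, ∏ i : ZMod m, B (w i) (w (i + 1)) := by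
  obtain ⟨m, rfl⟩ : ∃ e, m = e + 1 := ⟨m - 1, by have := NeZero.pos m; omega⟩
  change _ = ∑ w : Fin (m+1) → Fin 2, ∏ i : Fin (m+1), B (w i) (w (i + 1))
  rw [Matrix.trace, ← (Fin.consEquiv (fun _ : Fin (m+1) => Fin 2)).sum_comp,
      Fintype.sum_prod_type]
  apply Finset.sum_congr rfl
  intro a _
  rw [Matrix.diag, pow_path]
  apply Finset.sum_congr rfl
  intro w _
  apply Finset.prod_congr rfl
  intro i _
  simp only [Fin.consEquiv, Equiv.coe_fn_mk]
  rw [Fin.snoc_eq_cons_rotate]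
  simp only [finRotate_apply]

lemma trace_count (d m k : ℕ) [NeZero m] :
    (((!![1, 1; X ^ d, 0] : Matrix (Fin 2) (Fin 2) ℂ[X]) ^ m).trace).coeff k =
     (Nat.card {w : ZMod m → Fin 2 //
        d * (Finset.univ.filter (fun i => w i = 1)).card = k
          ∧ (∀ i : ZMod m, ¬(w i = 1 ∧ w (i + 1) = 1))} : ℂ) := by
  classical
  have hB : ∀ a b : Fin 2, (!![1, 1; X ^ d, 0] : Matrix (Fin 2) (Fin 2) ℂ[X]) a b
      = if (a = 1 ∧ b = 1) then 0 else (X ^ d) ^ (if a = 1 then 1 else 0) := by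
    intro a b
    fin_cases a <;> fin_cases b <;> simp
  rw [trace_pow_cyc, Polynomial.finset_sum_coeff, Nat.card_eq_fintype_card, Fintype.card_subtype,
    Finset.card_filter, Nat.cast_sum]
  apply Finset.sum_congr rfl
  intro w _
  by_cases h : ∀ i : ZMod m, ¬(w i = 1 ∧ w (i + 1) = 1)
  · have : ∏ i : ZMod m, (!![1, 1; X ^ d, 0] : Matrix (Fin 2) (Fin 2) ℂ[X]) (w i) (w (i + 1))
       = X ^ (d * (Finset.univ.filter (fun i => w i = 1)).card) := by
      rw [pow_mul, Finset.card_filter, ← Finset.prod_pow_eq_pow_sum]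
      apply Finset.prod_congr rfl
      intro i _
      rw [hB, if_neg (h i)]
    rw [this, Polynomial.coeff_X_pow]
    simp only [h, not_false_eq_true, implies_true, and_true, Nat.cast_ite, Nat.cast_one,
      Nat.cast_zero, eq_comm]
  · rw [if_neg (fun hh => h hh.2)]
    push Not at h
    obtain ⟨i, hi⟩ := h
    rw [Finset.prod_eq_zero (Finset.mem_univ i)]
    · simp
    · rw [hB, if_pos hi]

lemma count_eq (n : ℕ) [NeZero n] (k d m : ℕ) (hnm : n = m * d) [NeZero m]
    (g : ZMod n) (hg : addOrderOf g = d) :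
    Nat.card {w : ZMod n → Fin 2 //
        (Finset.univ.filter (fun i => w i = 1)).card = k
          ∧ (∀ i : ZMod n, ¬(w i = 1 ∧ w (i + 1) = 1))
          ∧ ∀ i, w (i + g) = w i} =
    Nat.card {w : ZMod m → Fin 2 //
        d * (Finset.univ.filter (fun i => w i = 1)).card = k
          ∧ (∀ i : ZMod m, ¬(w i = 1 ∧ w (i + 1) = 1))} := by
  classical
  have hmn : m ∣ n := ⟨d, hnm⟩
  have hd0 : 0 < d := by
    rcases Nat.eq_zero_or_pos d with h | h
    · subst h; exact absurd hnm (by simpa using NeZero.ne n)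
    · exact h
  set φ : ZMod n →+* ZMod m := ZMod.castHom hmn (ZMod m) with hφ
  have hsurj : Function.Surjective φ := ZMod.ringHom_surjective φ
  have hfib : ∀ y, (Finset.univ.filter (fun i => φ i = y)).card = d := by
    have hc : ∀ y, (Finset.univ.filter (fun i => φ i = y)).card
        = (Finset.univ.filter (fun i => φ i = 0)).card := by
      intro y
      obtain ⟨x, rfl⟩ := hsurj y
      apply Finset.card_bij (fun i _ => i - x)
      · intro a ha
        simp at ha ⊢
        simp [ha]
      · intro a _ b _ h
        simpa using h
      · intro b hb
        simp only [mem_filter, mem_univ, true_and] at hb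
        exact ⟨b + x, by simp [hb], by simp⟩
    have ht := Finset.card_eq_sum_card_fiberwise (f := φ) (s := Finset.univ) (t := Finset.univ)
      (by simp)
    simp only [hc, Finset.card_univ, ZMod.card, Finset.sum_const, smul_eq_mul] at ht
    intro y
    rw [hc]
    have : m * d = m * _ := hnm.symm.trans ht
    exact (Nat.eq_of_mul_eq_mul_left (NeZero.pos m) this).symm
  have hg0 : φ g = 0 := by
    have h1 : d • g = 0 := by rw [← hg]; exact addOrderOf_nsmul_eq_zero g
    rw [← ZMod.natCast_zmod_val g, ← Nat.cast_smul_eq_nsmul (ZMod n), smul_eq_mul,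
      ← Nat.cast_mul, ZMod.natCast_eq_zero_iff] at h1
    replace h1 : d * m ∣ d * g.val := by rwa [mul_comm d m, ← hnm]
    have h2 := Nat.dvd_of_mul_dvd_mul_left hd0 h1
    rw [← ZMod.natCast_zmod_val g, map_natCast, ZMod.natCast_eq_zero_iff]
    exact h2
  have hker : ∀ x, φ x = 0 → x ∈ AddSubgroup.zmultiples g := by
    intro x hx
    have hsub : (Finset.univ.filter (fun i => i ∈ AddSubgroup.zmultiples g)) ⊆
        (Finset.univ.filter (fun i => φ i = 0)) := by
      intro i hi
      simp only [mem_filter, mem_univ, true_and] at hi ⊢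
      obtain ⟨z, rfl⟩ := AddSubgroup.mem_zmultiples_iff.1 hi
      rw [map_zsmul, hg0, smul_zero]
    have hcard : (Finset.univ.filter (fun i => i ∈ AddSubgroup.zmultiples g)).card = d := by
      rw [← hg, ← Nat.card_zmultiples, Nat.card_eq_fintype_card, Fintype.card_subtype]
    have := Finset.eq_of_subset_of_card_le hsub (by rw [hfib, hcard])
    have hx' : x ∈ (Finset.univ.filter (fun i => φ i = 0)) := by simp [hx]
    rw [← this] at hx'
    simpa using hx'
  have hcount : ∀ v : ZMod m → Fin 2, (Finset.univ.filter (fun i => v (φ i) = 1)).card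
      = d * (Finset.univ.filter (fun i => v i = 1)).card := by
    intro v
    rw [Finset.card_eq_sum_card_fiberwise (f := φ) (t := Finset.univ.filter (fun i => v i = 1))
      (by intro i hi; simpa using hi), mul_comm, ← smul_eq_mul, ← Finset.sum_const]
    apply Finset.sum_congr rfl
    intro y hy
    rw [← hfib y]
    congr 1
    ext i
    simp only [mem_filter, mem_univ, true_and] at hy ⊢
    constructor
    · exact fun h => h.2
    · rintro rfl; exact ⟨hy, rfl⟩
  symm
  refine Nat.card_eq_of_bijective (fun v => ⟨fun i => v.1 (φ i), ?_, ?_, ?_⟩) ⟨?_, ?_⟩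
  · rw [hcount]; exact v.2.1
  · intro i
    simp only [map_add, map_one]
    exact v.2.2 _
  · intro i
    simp only [map_add, hg0, add_zero]
  · intro v v' h
    apply Subtype.ext
    funext y
    obtain ⟨x, rfl⟩ := hsurj y
    exact congrFun (congrArg Subtype.val h) x
  · rintro ⟨w, h1, h2, h3⟩
    have h3' : ∀ (j : ℕ) i, w (i + j • g) = w i := by
      intro j
      induction j with
      | zero => simp
      | succ j ih => intro i; rw [succ_nsmul, ← add_assoc, h3, ih]
    have hw : ∀ i j, φ i = φ j → w i = w j := by
      intro i j hij
      have := hker (i - j) (by rw [map_sub, hij, sub_self])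
      rw [← mem_multiples_iff_mem_zmultiples] at this
      obtain ⟨z, hz⟩ := AddSubmonoid.mem_multiples_iff _ _ |>.1 this
      rw [← h3' z j, hz]
      congr 1
      ring
    have hv : ∀ i, w (Function.surjInv hsurj (φ i)) = w i := fun i =>
      hw _ _ (Function.surjInv_eq hsurj _)
    refine ⟨⟨fun y => w (Function.surjInv hsurj y), ?_, ?_⟩, ?_⟩
    · rw [← hcount]
      simp only [hv]
      exact h1
    · intro y
      obtain ⟨x, rfl⟩ := hsurj y
      rw [← map_one φ, ← map_add]
      simp only [hv]
      exact h2 x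
    · apply Subtype.ext
      funext i
      exact hv i

/-- The triple `(C_{n,k}, ℤ/nℤ, e_{n,k}(q))` exhibits the cyclic sieving phenomenon: for every
`g ∈ ℤ/nℤ` and every complex root of unity `ω` of the same order as `g`, the number of words
of length `n` with `k` ones and `n - k` zeros, no two ones cyclically adjacent, fixed by
rotation by `g`, equals `e_{n,k}(ω)`. -/
theorem stmt9 (n : ℕ) [NeZero n] (hn : 1 ≤ n) (k : ℕ) (hk : k ≤ (n + 1) / 2)
    (g : ZMod n) (ω : ℂ) (hω : orderOf ω = addOrderOf g) :
    (Nat.card {w : ZMod n → Fin 2 //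
        (Finset.univ.filter (fun i => w i = 1)).card = k
          ∧ (∀ i : ZMod n, ¬(w i = 1 ∧ w (i + 1) = 1))
          ∧ ∀ i, w (i + g) = w i} : ℂ)
      = Polynomial.aeval ω (eSeq n k) := by
  set d := addOrderOf g with hd
  have hprim : IsPrimitiveRoot ω d := by rw [← hω]; exact IsPrimitiveRoot.orderOf ω
  have hdpos : 0 < d := addOrderOf_pos g
  have hdn : d ∣ n := by
    have := addOrderOf_dvd_card (x := g)
    rwa [ZMod.card] at this
  obtain ⟨m, hm⟩ := hdn
  have hm' : n = m * d := by rw [hm, mul_comm]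
  haveI : NeZero m := ⟨by rintro rfl; simp at hm; omega⟩
  rw [count_eq n k d m hm' g hd.symm, ← trace_count, eSeq_eq]
  have hQ : Qm ω 1 n = Qm ω 1 d ^ m := by rw [← Qm_mul ω d hprim.pow_eq_one, ← hm']
  rw [hQ]
  congr 1
  apply trace_pow_eq
  · rw [trace_one ω d hdpos hprim, Matrix.trace_fin_two]; simp
  · rw [det_Qm' ω d hdpos hprim, Matrix.det_fin_two]; simp
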